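/- Let w be a ternary word with w = ϑ₁(w) and let a be a letter such that w·a = ϑ₂(w·a), where ϑ₁, ϑ₂ ∈ {R,E_0,E_1,E_2}. Then there exist pairwise distinct letters i, j, k ∈ {0,1,2} such that w·a is a prefix of one of the infinite periodic words i^ω, (ij)^ω, (ijk)^ω. -/

import Mathlib

/-- The ternary alphabet. -/
abbrev Letter := Fin 3

/-- Finite words over the ternary alphabet. -/
abbrev Word := List Letter

/-- The four involutory antimorphisms of ternary words: the reversal `R`
and, for each letter `i`, the antimorphism `E i`. -/
inductive AM where
  | R : AM
  | E : Letter → AM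
deriving DecidableEq

/-- The action of an antimorphism on a single letter: `R` fixes every letter,
and `E i` fixes `i` and exchanges the other two letters (in `Fin 3`,
this involution is `a ↦ -(i + a)`). -/
def AM.letter : AM → Letter → Letter
  | .R, _a => _a
  | .E i, a => -(i + a)

/-- The action of an antimorphism on a word: letterwise image followed by reversal. -/
def AM.apply (t : AM) (w : Word) : Word := (w.map t.letter).reverse

/-- A word is a pseudopalindrome if it is a `ϑ`-palindrome for some
`ϑ ∈ {R, E_0, E_1, E_2}`. -/
def IsPseudopal (w : Word) : Prop := ∃ t : AM, t.apply w = w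

/-- `v` is an image of `w` if `v = ϑ(w)` for some `ϑ ∈ {R, E_0, E_1, E_2}`. -/
def IsImage (w v : Word) : Prop := ∃ t : AM, v = t.apply w

/-- `v` is the `ϑ`-palindromic closure of `u`: the shortest `ϑ`-palindrome
having `u` as a prefix. -/
def IsPalClosure (t : AM) (u v : Word) : Prop :=
  u <+: v ∧ t.apply v = v ∧
    ∀ v' : Word, u <+: v' → t.apply v' = v' → v.length ≤ v'.length

/-- `w` is the sequence of prefixes associated with the directive bi-sequence
`(Δ, Θ)`: `w 0 = ε` and `w (n+1) = (w n · δ_{n+1})^{ϑ_{n+1}}`. -/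
def DirectivePrefixes (Δ : ℕ → Letter) (Θ : ℕ → AM) (w : ℕ → Word) : Prop :=
  w 0 = [] ∧ ∀ n : ℕ, IsPalClosure (Θ (n + 1)) (w n ++ [Δ (n + 1)]) (w (n + 1))

/-- A pseudopalindromic prefix `v` of `w_{n+1}` is missed between `w_n` and `w_{n+1}`
if `|w_n| < |v| < |w_{n+1}|`. -/
def MissedBetween (wn wn1 v : Word) : Prop :=
  v <+: wn1 ∧ IsPseudopal v ∧ wn.length < v.length ∧ v.length < wn1.length

/-- An image of `u` occurs in `v` at (0-indexed) position `p`. -/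
def OccursImageAt (u v : Word) (p : ℕ) : Prop :=
  p + u.length ≤ v.length ∧ IsImage u ((v.drop p).take u.length)

/-- Assumption A for the pair `(wn, wn1)`: some image of `wn` occurs in `wn1`
at a position `p` with `0 < p < |wn1| - |wn|`, overlapping both the prefix
occurrence of `wn` and the suffix occurrence of an image of `wn`. -/
def AssumptionA (wn wn1 : Word) : Prop :=
  ∃ p : ℕ, 0 < p ∧ p < wn1.length - wn.length ∧ p < wn.length ∧
    wn1.length - wn.length < p + wn.length ∧ OccursImageAt wn wn1 p

/-- The prefix of length `n` of the directive bi-sequence is normalized: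
every pseudopalindromic prefix of `w n` equals `w k` for some `k ≤ n`. -/
def NormalizedUpTo (w : ℕ → Word) (n : ℕ) : Prop :=
  ∀ v : Word, v <+: w n → IsPseudopal v → ∃ k : ℕ, k ≤ n ∧ v = w k

/-- `rep u l` is the `l`-fold concatenation `u^l`. -/
def rep (u : Word) (l : ℕ) : Word := (List.replicate l u).flatten

/-- `rmSuf x y` is `x · y⁻¹`: the word `x` with its suffix of length `|y|` removed. -/
def rmSuf (x y : Word) : Word := x.take (x.length - y.length)

/-- `v` is a prefix of the infinite periodic word `pat^ω`. -/
def IsPrefixOfPow (pat v : Word) : Prop :=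
  ∀ q : ℕ, ∀ hq : q < v.length, ∃ hp : q % pat.length < pat.length,
    v.get ⟨q, hq⟩ = pat.get ⟨q % pat.length, hp⟩
/-- Reading a `t`-palindrome backwards amounts to applying `t` letterwise. -/
theorem AM.letter_getElem_of_apply_eq {t : AM} {w : Word} (h : t.apply w = w) {p q : ℕ}
    (hq : q < w.length) (hpq : p + q + 1 = w.length) :
    w[q] = t.letter w[p] := by
  have h' : w[q]? = (t.apply w)[q]? := by rw [h]
  have hp : w.length - 1 - q = p := by omega
  simpa [AM.apply, List.getElem?_reverse, hq, hp, List.getElem?_eq_getElem (show p < w.length by omega)]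
    using h'

/-- If `w` is a `t₁`-palindrome and `w·a` is a `t₂`-palindrome, each letter of `w·a` is obtained
from the preceding one by the permutation `t₂ ∘ t₁`. -/
theorem AM.getElem_succ_of_apply_eq {t₁ t₂ : AM} {w : Word} {a : Letter}
    (h₁ : t₁.apply w = w) (h₂ : t₂.apply (w ++ [a]) = w ++ [a]) (p : ℕ)
    (hp : p + 1 < (w ++ [a]).length) :
    (w ++ [a])[p + 1] = t₂.letter (t₁.letter (w ++ [a])[p]) := by
  have hp' : p < w.length := by simpa using hp
  rw [AM.letter_getElem_of_apply_eq h₂ (p := w.length - 1 - p) hp (by simp; omega),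
    List.getElem_append_left (show w.length - 1 - p < w.length by omega),
    List.getElem_append_left hp',
    AM.letter_getElem_of_apply_eq h₁ (p := p) (q := w.length - 1 - p) (by omega) (by omega)]

/-- A word generated from its first letter by iterating `f` follows any cycle of `f`
starting at that letter. -/
theorem isPrefixOfPow_of_cycle {f : Letter → Letter} {pat v : Word} (hpat : 0 < pat.length)
    (hv : 0 < v.length) (h₀ : v[0] = pat[0])
    (hstep : ∀ (p : ℕ) (hp : p + 1 < v.length), v[p + 1] = f v[p])
    (hcycle : ∀ (r : ℕ) (hr : r < pat.length),
      f pat[r] = pat[(r + 1) % pat.length]'(Nat.mod_lt _ hpat)) :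
    IsPrefixOfPow pat v := by
  intro q hq
  refine ⟨Nat.mod_lt _ hpat, ?_⟩
  simp only [List.get_eq_getElem]
  induction q with
  | zero => simpa using h₀
  | succ q ih =>
    rw [hstep q hq, ih (by omega), hcycle _ (Nat.mod_lt _ hpat)]
    simp only [Nat.mod_add_mod]

/-- The cycle of `t₂ ∘ t₁` through a letter has length at most three. -/
theorem AM.exists_cycle (t₁ t₂ : AM) (i : Letter) :
    ∃ j k : Letter, i ≠ j ∧ j ≠ k ∧ i ≠ k ∧
      (t₂.letter (t₁.letter i) = i ∨
        (t₂.letter (t₁.letter i) = j ∧ t₂.letter (t₁.letter j) = i) ∨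
        (t₂.letter (t₁.letter i) = j ∧ t₂.letter (t₁.letter j) = k ∧
          t₂.letter (t₁.letter k) = i)) := by
  rcases t₁ with _ | x <;> rcases t₂ with _ | y <;> simp only [AM.letter]
  · revert i; decide
  · revert i y; decide
  · revert i x; decide
  · revert i x y; decide

/-- Lemma: if `w` is a `ϑ₁`-palindrome and `w·a` is a `ϑ₂`-palindrome, then `w·a`
is a prefix of `i^ω`, `(ij)^ω` or `(ijk)^ω` for some pairwise distinct letters. -/
theorem one_letter_extension_is_periodic (t₁ t₂ : AM) (w : Word) (a : Letter)
    (h₁ : t₁.apply w = w) (h₂ : t₂.apply (w ++ [a]) = w ++ [a]) :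
    ∃ i j k : Letter, i ≠ j ∧ j ≠ k ∧ i ≠ k ∧
      (IsPrefixOfPow [i] (w ++ [a]) ∨ IsPrefixOfPow [i, j] (w ++ [a]) ∨
        IsPrefixOfPow [i, j, k] (w ++ [a])) := by
  have hv : 0 < (w ++ [a]).length := by simp
  have hstep := AM.getElem_succ_of_apply_eq h₁ h₂
  obtain ⟨i, hi⟩ : ∃ i, (w ++ [a])[0] = i := ⟨_, rfl⟩
  obtain ⟨j, k, hij, hjk, hik, hc⟩ := AM.exists_cycle t₁ t₂ i
  refine ⟨i, j, k, hij, hjk, hik, hc.imp (fun h => ?_) (Or.imp (fun h => ?_) (fun h => ?_))⟩ <;>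
    refine isPrefixOfPow_of_cycle (f := fun x => t₂.letter (t₁.letter x)) (by simp) hv hi hstep
      fun r hr => ?_ <;>
    simp only [List.length_cons, List.length_nil] at hr <;>
    interval_cases r <;>
    simp [h]
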